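/- Let K be an algebraically closed field and fix n ≥ 1 and d ≥ 1. Let M be the (finite) set of monomials in y₁, …, yₙ of total degree at most d. Then the set { c ∈ K^M : the polynomial Σ_{μ ∈ M} c_μ · μ is irreducible in K[y₁, …, yₙ] } is a constructible subset of K^M with respect to the Zariski topology. (This is the key step (c) in the base case of the proof of Theorem A.2 of the paper's appendix: irreducibility of a polynomial of bounded degree is a definable condition on its coefficients.) -/

import Mathlib

/-- The Zariski topology on affine space `σ → K`: the closed sets are the common
zero loci of sets of polynomials over `K`. -/
def zariskiTopology (K : Type*) [CommRing K] (σ : Type*) :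
    TopologicalSpace (σ → K) :=
  TopologicalSpace.generateFrom
    {U | ∃ f : MvPolynomial σ K, U = {x | MvPolynomial.eval x f ≠ 0}}

/-- A set is constructible w.r.t. a topology `t` if it is a finite union of
differences of `t`-closed sets (equivalently, a finite Boolean combination of
closed sets). -/
def IsConstructibleIn {α : Type*} (t : TopologicalSpace α) (S : Set α) : Prop :=
  ∃ (r : ℕ) (C D : Fin r → Set α),
    (∀ i, @IsClosed _ t (C i)) ∧ (∀ i, @IsClosed _ t (D i)) ∧
    S = ⋃ i, C i \ D i

/-- The set of monomials in `n` variables of total degree at most `d`, encoded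
by their exponent vectors. -/
abbrev MonoLe (n d : ℕ) : Type :=
  {e : Fin n → Fin (d + 1) // (∑ i, ((e i : ℕ))) ≤ d}

/-- The polynomial `Σ_{μ ∈ M} c_μ · μ` with coefficient tuple `c`. -/
noncomputable def polyOf {K : Type*} [CommRing K] {n d : ℕ}
    (c : MonoLe n d → K) : MvPolynomial (Fin n) K :=
  ∑ e : MonoLe n d,
    MvPolynomial.monomial (Finsupp.equivFunOnFinite.symm fun i => ((e.1 i : ℕ)))
      (c e)

namespace MvPolynomial

open PrimeSpectrum Topology

section Points

variable {K σ τ : Type*} [Field K]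

lemma mem_zeroLocus_pointToPoint {s : Set (MvPolynomial σ K)} {x : σ → K} :
    pointToPoint x ∈ PrimeSpectrum.zeroLocus s ↔ ∀ f ∈ s, eval x f = 0 := by
  refine forall₂_congr fun f _ ↦ ?_
  change f ∈ vanishingIdeal K {x} ↔ _
  rw [mem_vanishingIdeal_singleton_iff, aeval_eq_eval]

lemma pointToPoint_mem_basicOpen {f : MvPolynomial σ K} {x : σ → K} :
    pointToPoint x ∈ basicOpen f ↔ eval x f ≠ 0 := by
  rw [PrimeSpectrum.mem_basicOpen]
  change ¬ f ∈ vanishingIdeal K {x} ↔ _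
  rw [mem_vanishingIdeal_singleton_iff, aeval_eq_eval]

lemma pointToPoint_injective :
    Function.Injective (pointToPoint : (σ → K) → PrimeSpectrum (MvPolynomial σ K)) := by
  intro x y h
  funext i
  have hx : pointToPoint x ∈ PrimeSpectrum.zeroLocus {X i - C (x i)} := by
    simp [mem_zeroLocus_pointToPoint, -PrimeSpectrum.mem_zeroLocus]
  rw [h, mem_zeroLocus_pointToPoint] at hx
  simpa [sub_eq_zero, eq_comm] using hx _ rfl

lemma comap_pointToPoint (φ : MvPolynomial σ K →ₐ[K] MvPolynomial τ K) (y : τ → K) :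
    PrimeSpectrum.comap φ.toRingHom (pointToPoint y) = pointToPoint fun i ↦ eval y (φ (X i)) := by
  ext f
  change φ f ∈ vanishingIdeal K {y} ↔ f ∈ vanishingIdeal K {_}
  rw [mem_vanishingIdeal_singleton_iff, mem_vanishingIdeal_singleton_iff]
  have : (aeval y).comp φ = aeval fun i ↦ eval y (φ (X i)) := by
    ext i
    simp [aeval_eq_eval]
  rw [← this, AlgHom.comp_apply]

lemma isClosed_pointToPoint [Finite σ] [IsAlgClosed K] (x : σ → K) :
    IsClosed {(pointToPoint x : PrimeSpectrum (MvPolynomial σ K))} := by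
  rw [isClosed_singleton_iff_isMaximal]
  exact isMaximal_iff_eq_vanishingIdeal_singleton.mpr ⟨x, rfl⟩

lemma exists_eq_pointToPoint_of_isClosed [Finite σ] [IsAlgClosed K]
    {q : PrimeSpectrum (MvPolynomial σ K)} (hq : IsClosed {q}) : ∃ x : σ → K, q = pointToPoint x := by
  rw [isClosed_singleton_iff_isMaximal] at hq
  obtain ⟨x, hx⟩ := isMaximal_iff_eq_vanishingIdeal_singleton.mp hq
  exact ⟨x, PrimeSpectrum.ext hx⟩

/-- A rational point lies in the image of an open subset of the spectrum exactly when it is the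
image of a rational point of this open subset. -/
lemma pointToPoint_mem_comap_image_iff [Finite σ] [Finite τ] [IsAlgClosed K]
    (φ : MvPolynomial σ K →ₐ[K] MvPolynomial τ K) {Z : Set (PrimeSpectrum (MvPolynomial τ K))}
    (hZ : IsOpen Z) (x : σ → K) :
    pointToPoint x ∈ PrimeSpectrum.comap φ.toRingHom '' Z ↔
      ∃ y : τ → K, pointToPoint y ∈ Z ∧ (fun i ↦ eval y (φ (X i))) = x := by
  constructor
  · rintro ⟨p, hp, hpx⟩
    have hW : IsLocallyClosed (Z ∩ PrimeSpectrum.comap φ.toRingHom ⁻¹' {pointToPoint x}) :=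
      hZ.isLocallyClosed.inter
        ((isClosed_pointToPoint x).preimage (PrimeSpectrum.continuous_comap φ.toRingHom)).isLocallyClosed
    obtain ⟨q, ⟨hqZ, hqx⟩, hq⟩ := nonempty_inter_closedPoints (Set.nonempty_of_mem (Set.mem_inter hp hpx)) hW
    obtain ⟨y, rfl⟩ := exists_eq_pointToPoint_of_isClosed hq
    refine ⟨y, hqZ, pointToPoint_injective ?_⟩
    rw [← comap_pointToPoint]
    exact hqx
  · rintro ⟨y, hy, rfl⟩
    exact ⟨_, hy, comap_pointToPoint φ y⟩

lemma finitePresentation_algHom [Finite σ] [Finite τ]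
    (φ : MvPolynomial σ K →ₐ[K] MvPolynomial τ K) : φ.toRingHom.FinitePresentation := by
  refine RingHom.FinitePresentation.of_finiteType.mp
    (RingHom.FiniteType.of_comp_finiteType (f := algebraMap K _) ?_)
  have : φ.toRingHom.comp (algebraMap K _) = algebraMap K _ := φ.comp_algebraMap
  rw [this, RingHom.finiteType_algebraMap]
  infer_instance

lemma isClosed_zariskiTopology (s : Set (MvPolynomial σ K)) :
    IsClosed[_root_.zariskiTopology K σ] {x | ∀ f ∈ s, eval x f = 0} := by
  let := _root_.zariskiTopology K σ
  have : {x : σ → K | ∀ f ∈ s, eval x f = 0} = ⋂ f ∈ s, {x | eval x f ≠ 0}ᶜ := by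
    ext x
    simp
  rw [this]
  refine isClosed_biInter fun f _ ↦ IsOpen.isClosed_compl ?_
  exact TopologicalSpace.isOpen_generateFrom_of_mem ⟨f, rfl⟩

lemma isConstructibleIn_preimage_pointToPoint {S : Set (PrimeSpectrum (MvPolynomial σ K))}
    (hS : IsConstructible S) :
    IsConstructibleIn (_root_.zariskiTopology K σ) {x | pointToPoint x ∈ S} := by
  obtain ⟨T, rfl⟩ := exists_constructibleSetData_iff.mpr hS
  let e := T.equivFin.symm
  refine ⟨T.card, fun i ↦ {x | ∀ f ∈ Set.range (e i).1.g, eval x f = 0},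
    fun i ↦ {x | ∀ f ∈ ({(e i).1.f} : Set _), eval x f = 0},
    fun i ↦ isClosed_zariskiTopology _, fun i ↦ isClosed_zariskiTopology _, ?_⟩
  ext x
  simp only [Set.mem_iUnion, Set.mem_sdiff, Set.mem_ofPred_eq, ← mem_zeroLocus_pointToPoint,
    ConstructibleSetData.toSet, BasicConstructibleSetData.toSet]
  constructor
  · rintro ⟨C, hC, hx⟩
    exact ⟨e.symm ⟨C, hC⟩, by rwa [e.apply_symm_apply]⟩
  · rintro ⟨i, hx⟩
    exact ⟨(e i).1, (e i).2, hx⟩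

end Points

end MvPolynomial

namespace MonoLe

variable {n d : ℕ}

/-- The exponent vector of a monomial of degree at most `d`, as a finitely supported function. -/
noncomputable def exponent (e : MonoLe n d) : Fin n →₀ ℕ :=
  Finsupp.equivFunOnFinite.symm fun i ↦ (e.1 i : ℕ)

lemma exponent_injective : Function.Injective (exponent : MonoLe n d → Fin n →₀ ℕ) := by
  intro e e' h
  ext i
  exact DFunLike.congr_fun h i

lemma degree_exponent_le (e : MonoLe n d) : e.exponent.degree ≤ d := by
  rw [Finsupp.degree_eq_sum]
  exact e.2

lemma exists_exponent_eq {m : Fin n →₀ ℕ} (hm : m.degree ≤ d) :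
    ∃ e : MonoLe n d, e.exponent = m := by
  refine ⟨⟨fun i ↦ ⟨m i, Nat.lt_succ_of_le ((Finsupp.le_degree i m).trans hm)⟩, ?_⟩, ?_⟩
  · rwa [Finsupp.degree_eq_sum] at hm
  · ext i
    rfl

end MonoLe

section polyOf

open MvPolynomial

variable {n d : ℕ}

section CommRing

variable {R S : Type*} [CommRing R] [CommRing S]

lemma coeff_polyOf_exponent (c : MonoLe n d → R) (e : MonoLe n d) :
    coeff e.exponent (polyOf c) = c e := by
  classical
  rw [polyOf, coeff_sum, Finset.sum_eq_single e]
  · exact (coeff_monomial _ _ _).trans (if_pos rfl)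
  · intro e' _ h
    exact (coeff_monomial _ _ _).trans (if_neg fun h' ↦ h (MonoLe.exponent_injective h'))
  · simp

lemma totalDegree_polyOf_le (c : MonoLe n d → R) : (polyOf c).totalDegree ≤ d := by
  refine totalDegree_finsetSum_le fun e _ ↦ (totalDegree_monomial_le _ _).trans ?_
  exact e.degree_exponent_le

lemma eq_of_coeff_exponent_eq {p q : MvPolynomial (Fin n) R} (hp : p.totalDegree ≤ d)
    (hq : q.totalDegree ≤ d) (h : ∀ e : MonoLe n d, coeff e.exponent p = coeff e.exponent q) :
    p = q := by
  ext m
  by_cases hm : m.degree ≤ d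
  · obtain ⟨e, rfl⟩ := MonoLe.exists_exponent_eq hm
    exact h e
  · rw [coeff_eq_zero_of_totalDegree_lt, coeff_eq_zero_of_totalDegree_lt] <;>
    · change _ < m.degree
      lia

lemma exists_polyOf_eq {p : MvPolynomial (Fin n) R} (hp : p.totalDegree ≤ d) :
    ∃ c : MonoLe n d → R, polyOf c = p :=
  ⟨fun e ↦ coeff e.exponent p, eq_of_coeff_exponent_eq (totalDegree_polyOf_le _) hp
    fun e ↦ coeff_polyOf_exponent _ e⟩

lemma map_polyOf (f : R →+* S) (c : MonoLe n d → R) : map f (polyOf c) = polyOf (f ∘ c) := by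
  simp [polyOf, map_monomial]

lemma totalDegree_polyOf_ne_zero_iff (c : MonoLe n d → R) :
    (polyOf c).totalDegree ≠ 0 ↔ ∃ e : MonoLe n d, e.exponent ≠ 0 ∧ c e ≠ 0 := by
  constructor
  · contrapose!
    intro h
    rw [totalDegree_eq_zero_iff_eq_C]
    refine eq_of_coeff_exponent_eq (totalDegree_polyOf_le c) (by simp) fun e ↦ ?_
    by_cases he : e.exponent = 0
    · rw [he, coeff_zero_C]
    · rw [coeff_polyOf_exponent, h e he, coeff_C, if_neg (Ne.symm he)]
  · rintro ⟨e, he, hc⟩ h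
    rw [totalDegree_eq_zero_iff_eq_C] at h
    rw [← coeff_polyOf_exponent c e, h, coeff_C, if_neg (Ne.symm he)] at hc
    exact hc rfl

/-- The ring homomorphism corresponding to the multiplication of polynomials of degrees at most
`k` and `l`, truncated to its coefficients of degree at most `d`. -/
noncomputable def mulCoeffs (R : Type*) [CommRing R] (n k l d : ℕ) :
    MvPolynomial (MonoLe n d) R →ₐ[R] MvPolynomial (MonoLe n k ⊕ MonoLe n l) R :=
  aeval fun e ↦ coeff e.exponent
    (polyOf (fun i ↦ X (Sum.inl i)) * polyOf (fun j ↦ X (Sum.inr j)))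

lemma eval_mulCoeffs_X {k l : ℕ} (y : MonoLe n k ⊕ MonoLe n l → R) (e : MonoLe n d) :
    eval y (mulCoeffs R n k l d (X e)) =
      coeff e.exponent (polyOf (y ∘ Sum.inl) * polyOf (y ∘ Sum.inr)) := by
  rw [mulCoeffs, aeval_X, ← coeff_map, map_mul, map_polyOf, map_polyOf]
  simp [Function.comp_def]

lemma eval_mulCoeffs_X_eq_iff {k l : ℕ} (h : k + l ≤ d) (y : MonoLe n k ⊕ MonoLe n l → R)
    (c : MonoLe n d → R) :
    (fun e ↦ eval y (mulCoeffs R n k l d (X e))) = c ↔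
      polyOf (y ∘ Sum.inl) * polyOf (y ∘ Sum.inr) = polyOf c := by
  simp only [eval_mulCoeffs_X]
  constructor
  · intro hc
    refine eq_of_coeff_exponent_eq ((totalDegree_mul _ _).trans
      ((add_le_add (totalDegree_polyOf_le _) (totalDegree_polyOf_le _)).trans h))
      (totalDegree_polyOf_le c) fun e ↦ ?_
    rw [coeff_polyOf_exponent, ← hc]
  · rintro hc
    funext e
    rw [hc, coeff_polyOf_exponent]

end CommRing

variable {K : Type*} [Field K]

lemma MvPolynomial.isUnit_of_totalDegree_eq_zero {σ : Type*} {p : MvPolynomial σ K} (hp : p ≠ 0)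
    (h : p.totalDegree = 0) : IsUnit p := by
  obtain ⟨a, rfl⟩ : ∃ a, p = C a := ⟨_, totalDegree_eq_zero_iff_eq_C.mp h⟩
  exact (isUnit_iff_ne_zero.mpr fun ha ↦ hp (by simp [ha])).map C

lemma MvPolynomial.not_isUnit_of_totalDegree_ne_zero {σ : Type*} {p : MvPolynomial σ K}
    (h : p.totalDegree ≠ 0) : ¬ IsUnit p :=
  fun hp ↦ h (isUnit_iff_totalDegree_of_isReduced.mp hp).2

lemma irreducible_polyOf_iff (c : MonoLe n d → K) :
    Irreducible (polyOf c) ↔ (polyOf c).totalDegree ≠ 0 ∧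
      ¬ ∃ k : Fin (d + 1), ∃ y : MonoLe n k ⊕ MonoLe n (d - k) → K,
        ((polyOf (y ∘ Sum.inl)).totalDegree ≠ 0 ∧ (polyOf (y ∘ Sum.inr)).totalDegree ≠ 0) ∧
        polyOf (y ∘ Sum.inl) * polyOf (y ∘ Sum.inr) = polyOf c := by
  constructor
  · intro h
    refine ⟨fun h0 ↦ h.not_isUnit (isUnit_of_totalDegree_eq_zero h.ne_zero h0), ?_⟩
    rintro ⟨k, y, ⟨ha, hb⟩, hab⟩
    rcases h.isUnit_or_isUnit hab.symm with hu | hu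
    · exact not_isUnit_of_totalDegree_ne_zero ha hu
    · exact not_isUnit_of_totalDegree_ne_zero hb hu
  · rintro ⟨h0, h⟩
    refine ⟨not_isUnit_of_totalDegree_ne_zero h0, fun p q hpq ↦ ?_⟩
    by_contra! hu
    have hne : p * q ≠ 0 := by
      rw [← hpq]
      rintro hc
      simp [hc] at h0
    have hp := left_ne_zero_of_mul hne
    have hq := right_ne_zero_of_mul hne
    have hdeg := totalDegree_mul_of_isDomain hp hq
    have hle := totalDegree_polyOf_le c
    rw [hpq, hdeg] at hle
    obtain ⟨a, ha⟩ := exists_polyOf_eq (le_refl p.totalDegree)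
    obtain ⟨b, hb⟩ := exists_polyOf_eq (show q.totalDegree ≤ d - p.totalDegree by lia)
    refine h ⟨⟨p.totalDegree, by lia⟩, Sum.elim a b, ?_⟩
    rw [Sum.elim_comp_inl, Sum.elim_comp_inr, ha, hb]
    exact ⟨⟨fun h ↦ hu.1 (isUnit_of_totalDegree_eq_zero hp h),
      fun h ↦ hu.2 (isUnit_of_totalDegree_eq_zero hq h)⟩, hpq.symm⟩

/-- The open set of the spectrum on which the coordinates in `s` do not all vanish. -/
def someCoordNeZero (K : Type*) [Field K] {σ : Type*} (s : Set σ) :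
    Set (PrimeSpectrum (MvPolynomial σ K)) :=
  ⋃ i : s, PrimeSpectrum.basicOpen (X i.1 : MvPolynomial σ K)

lemma isOpen_someCoordNeZero {σ : Type*} (s : Set σ) : IsOpen (someCoordNeZero K s) :=
  isOpen_iUnion fun _ ↦ (PrimeSpectrum.basicOpen _).isOpen

lemma isConstructible_someCoordNeZero {σ : Type*} [Finite σ] (s : Set σ) :
    Topology.IsConstructible (someCoordNeZero K s) :=
  .iUnion fun _ ↦ PrimeSpectrum.isConstructible_basicOpen

lemma pointToPoint_mem_someCoordNeZero {σ : Type*} {s : Set σ} {x : σ → K} :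
    pointToPoint x ∈ someCoordNeZero K s ↔ ∃ i ∈ s, x i ≠ 0 := by
  simp only [someCoordNeZero, Set.mem_iUnion, SetLike.mem_coe, pointToPoint_mem_basicOpen, eval_X]
  simp

end polyOf

open MvPolynomial in
/-- Irreducibility of a polynomial of bounded degree is a definable condition on
its coefficients: over an algebraically closed field `K`, the set of coefficient
tuples `c ∈ K^M` (where `M` is the set of monomials in `y₁, …, yₙ` of total
degree at most `d`) for which `Σ_{μ ∈ M} c_μ · μ` is irreducible is a
constructible subset of `K^M`. -/
theorem irreducible_polynomial_definable
    {K : Type*} [Field K] [IsAlgClosed K] (n d : ℕ) (hn : 1 ≤ n) (hd : 1 ≤ d) :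
    IsConstructibleIn (zariskiTopology K (MonoLe n d))
      {c : MonoLe n d → K | Irreducible (polyOf c)} := by
  let U : Set (PrimeSpectrum (MvPolynomial (MonoLe n d) K)) :=
    someCoordNeZero K {e | e.exponent ≠ 0}
  let Z (k : Fin (d + 1)) :
      Set (PrimeSpectrum (MvPolynomial (MonoLe n k ⊕ MonoLe n (d - k)) K)) :=
    someCoordNeZero K (Sum.inl '' {e | e.exponent ≠ 0}) ∩
      someCoordNeZero K (Sum.inr '' {e | e.exponent ≠ 0})
  let T := U \ ⋃ k : Fin (d + 1), PrimeSpectrum.comap (mulCoeffs K n k (d - k) d).toRingHom '' Z k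
  have hT : Topology.IsConstructible T := by
    refine (isConstructible_someCoordNeZero _).sdiff (.iUnion fun k ↦ ?_)
    refine PrimeSpectrum.isConstructible_comap_image (finitePresentation_algHom _)
      ((isConstructible_someCoordNeZero _).inter (isConstructible_someCoordNeZero _))
  convert isConstructibleIn_preimage_pointToPoint hT using 1
  ext c
  have hZ (k) : IsOpen (Z k) := (isOpen_someCoordNeZero _).inter (isOpen_someCoordNeZero _)
  simp only [Set.mem_ofPred_eq, irreducible_polyOf_iff, T, Set.mem_sdiff, Set.mem_iUnion,
    pointToPoint_mem_comap_image_iff _ (hZ _)]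
  refine and_congr ?_ (not_congr (exists_congr fun k ↦ exists_congr fun y ↦ and_congr ?_ ?_))
  · rw [totalDegree_polyOf_ne_zero_iff, pointToPoint_mem_someCoordNeZero]
    rfl
  · simp only [Z, Set.mem_inter_iff, totalDegree_polyOf_ne_zero_iff,
      pointToPoint_mem_someCoordNeZero, Set.exists_mem_image]
    rfl
  · rw [eval_mulCoeffs_X_eq_iff (by lia)]
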